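/- For every odd positive integer n, every positive integer d, and every b ∈ ℤ^d, the quantity g_n(b) = Σ_{0 ≤ k < n, gcd(k,n)=1} Σ_{x ∈ {0,...,n-1}^d} e_n(b·x + k(x·x)) is n times an integer, i.e., there exists m ∈ ℤ with g_n(b) = n·m. -/

import Mathlib

open Finset

/-- `en n x = exp(2πi x / n)` -/
noncomputable def en (n : ℕ) (x : ℤ) : ℂ := Complex.exp (2 * Real.pi * Complex.I * x / n)

/-- `g_n(b) = Σ_{0 ≤ k < n, gcd(k,n)=1} Σ_{x ∈ {0,…,n-1}^d} e_n(b·x + k(x·x))`. -/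
noncomputable def gsum (n d : ℕ) (b : Fin d → ℤ) : ℂ :=
  ∑ k ∈ (Finset.range n).filter (fun k => Nat.gcd k n = 1),
    ∑ x ∈ Fintype.piFinset fun _ : Fin d => Finset.Ico (0:ℤ) n,
      en n (∑ i, b i * x i + k * ∑ i, x i ^ 2)

theorem en_add (n : ℕ) (x y : ℤ) : en n (x + y) = en n x * en n y := by
  simp only [en, ← Complex.exp_add]
  congr 1
  push_cast
  ring

theorem en_mul_nat (n : ℕ) (x : ℤ) (k : ℕ) : en n (x * k) = en n x ^ k := by
  simp only [en, ← Complex.exp_nat_mul]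
  congr 1
  push_cast
  ring

theorem en_sum {ι : Type*} (n : ℕ) (s : Finset ι) (f : ι → ℤ) :
    en n (∑ i ∈ s, f i) = ∏ i ∈ s, en n (f i) := by
  simp only [en, ← Complex.exp_sum]
  congr 1
  push_cast
  rw [Finset.mul_sum, Finset.sum_div]

theorem en_mul_mul_left {g m : ℕ} (hg : 0 < g) (x : ℤ) : en (g * m) (g * x) = en m x := by
  have hg' : (g : ℂ) ≠ 0 := by exact_mod_cast hg.ne'
  simp only [en]
  congr 1
  push_cast
  rw [← mul_div_mul_left _ (m : ℂ) hg']
  congr 1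
  ring

theorem en_eq_one_iff {n : ℕ} (hn : 0 < n) (x : ℤ) : en n x = 1 ↔ (n : ℤ) ∣ x := by
  have hn' : (n : ℂ) ≠ 0 := by exact_mod_cast hn.ne'
  rw [en, Complex.exp_eq_one_iff]
  have key : ∀ k : ℤ, 2 * Real.pi * Complex.I * x / n = k * (2 * Real.pi * Complex.I) ↔
      x = n * k := by
    intro k
    rw [div_eq_iff hn', ← @Int.cast_inj ℂ]
    push_cast
    constructor
    · intro h
      apply mul_left_cancel₀ Complex.two_pi_I_ne_zero
      rw [h]; ring
    · intro h
      rw [h]; ring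
  simp only [key]
  rfl

theorem en_congr {n : ℕ} (hn : 0 < n) {x y : ℤ} (h : x ≡ y [ZMOD n]) : en n x = en n y := by
  have h1 : en n (y - x) = 1 := (en_eq_one_iff hn _).2 h.dvd
  rw [← add_sub_cancel x y, en_add, h1, mul_one]

theorem isPrimitiveRoot_en_one {n : ℕ} (hn : 0 < n) : IsPrimitiveRoot (en n 1) n := by
  simpa [en] using Complex.isPrimitiveRoot_exp n hn.ne'

theorem sum_range_en_mul {n : ℕ} (hn : 0 < n) (x : ℤ) :
    ∑ k ∈ range n, en n (x * k) = if (n : ℤ) ∣ x then (n : ℂ) else 0 := by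
  simp only [en_mul_nat]
  split_ifs with h
  · simp [(en_eq_one_iff hn x).2 h]
  · have h1 : en n x ≠ 1 := fun e => h ((en_eq_one_iff hn x).1 e)
    have h2 : en n x ^ n = 1 := by
      rw [← en_mul_nat, en_eq_one_iff hn]
      exact dvd_mul_left _ _
    rw [geom_sum_eq h1, h2, sub_self, zero_div]

theorem sum_range_mul_eq {M : Type*} [AddCommMonoid M] (g m : ℕ) (f : ℕ → M) :
    ∑ x ∈ range (g * m), f x = ∑ z ∈ range g, ∑ y ∈ range m, f (m * z + y) := by
  induction g with
  | zero => simp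
  | succ g ih => rw [Nat.succ_mul, Finset.sum_range_add, ih, Finset.sum_range_succ, mul_comm g m]

theorem sum_Ico_int_eq_sum_range {M : Type*} [AddCommMonoid M] (n : ℕ) (f : ℤ → M) :
    ∑ x ∈ Ico (0 : ℤ) n, f x = ∑ x ∈ range n, f x := by
  symm
  refine Finset.sum_nbij' (fun x : ℕ => (x : ℤ)) Int.toNat ?_ ?_ ?_ ?_ ?_ <;>
    intro x <;> simp <;> omega

/-- The one-dimensional quadratic sum `Σ_{x mod n} e_n(b x + k x²)`. -/
noncomputable def quadSum (n : ℕ) (k b : ℤ) : ℂ := ∑ x ∈ range n, en n (b * x + k * (x : ℤ) ^ 2)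

theorem sum_piFinset_en (n d : ℕ) (k : ℤ) (b : Fin d → ℤ) :
    ∑ x ∈ Fintype.piFinset fun _ : Fin d => Ico (0 : ℤ) n,
      en n (∑ i, b i * x i + k * ∑ i, x i ^ 2) = ∏ i, quadSum n k (b i) := by
  have hq : ∀ c : ℤ, quadSum n k c = ∑ x ∈ Ico (0 : ℤ) n, en n (c * x + k * x ^ 2) :=
    fun c => (sum_Ico_int_eq_sum_range n fun x => en n (c * x + k * x ^ 2)).symm
  simp only [hq]
  rw [Finset.prod_univ_sum]
  refine Finset.sum_congr rfl fun x _ => ?_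
  rw [Finset.mul_sum, ← Finset.sum_add_distrib, en_sum]

theorem quadSum_mul {g m : ℕ} (hg : 0 < g) (hm : 0 < m) (k b : ℤ) :
    quadSum (g * m) (g * k) b = if (g : ℤ) ∣ b then g * quadSum m k (b / g) else 0 := by
  have hgm : 0 < g * m := Nat.mul_pos hg hm
  have key : ∀ z y : ℕ, en (g * m) (b * (m * z + y : ℕ) + g * k * ((m * z + y : ℕ) : ℤ) ^ 2) =
      en g (b * z) * en (g * m) (b * y + g * k * (y : ℤ) ^ 2) := by
    intro z y
    rw [← en_mul_mul_left hm (b * z), mul_comm m g, ← en_add]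
    apply en_congr hgm
    rw [Int.modEq_iff_dvd]
    refine ⟨-(k * (m * z ^ 2 + 2 * z * y)), ?_⟩
    push_cast
    ring
  rw [quadSum, sum_range_mul_eq]
  simp only [key, ← Finset.mul_sum, ← Finset.sum_mul, sum_range_en_mul hg]
  split_ifs with h
  · obtain ⟨c, rfl⟩ := h
    have hg' : (g : ℤ) ≠ 0 := by exact_mod_cast hg.ne'
    rw [Int.mul_ediv_cancel_left _ hg', quadSum]
    congr 1
    refine Finset.sum_congr rfl fun y _ => ?_
    rw [← en_mul_mul_left hg (c * y + k * (y : ℤ) ^ 2)]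
    congr 1
    ring
  · rw [zero_mul]

open Polynomial in
/-- If an integer polynomial takes a constant value on the primitive `n`-th roots of unity, then
that value is an integer. -/
theorem exists_int_of_aeval_primitiveRoots {n : ℕ} (hn : 0 < n) (P : ℤ[X]) (s : ℂ)
    (h : ∀ μ : ℂ, IsPrimitiveRoot μ n → aeval μ P = s) : ∃ m : ℤ, s = m := by
  set R := P %ₘ cyclotomic n ℤ with hR
  have hmonic := cyclotomic.monic n ℤ
  have hval : ∀ μ : ℂ, IsPrimitiveRoot μ n → aeval μ R = s := by
    intro μ hμ
    rw [← h μ hμ, hR]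
    apply aeval_modByMonic_eq_self_of_root
    have := hμ.isRoot_cyclotomic hn
    rwa [IsRoot.def, ← map_cyclotomic_int, eval_map, ← algebraMap_int_eq, ← aeval_def] at this
  have hzero : R.map (Int.castRingHom ℂ) - C s = 0 := by
    apply eq_zero_of_degree_lt_of_eval_finset_eq_zero (primitiveRoots n ℂ)
    · rw [(Complex.isPrimitiveRoot_exp n hn.ne').card_primitiveRoots]
      refine lt_of_le_of_lt (degree_sub_le _ _) (max_lt ?_ ?_)
      · refine lt_of_le_of_lt degree_map_le ?_
        rw [← degree_cyclotomic n ℤ]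
        exact degree_modByMonic_lt _ hmonic
      · refine lt_of_le_of_lt degree_C_le ?_
        exact_mod_cast Nat.totient_pos.2 hn
    · intro μ hμ
      have := hval μ (isPrimitiveRoot_of_mem_primitiveRoots hμ)
      rw [eval_sub, eval_C, eval_map, ← algebraMap_int_eq, ← aeval_def, this, sub_self]
  refine ⟨R.coeff 0, ?_⟩
  have := congrArg (fun Q => coeff Q 0) hzero
  simp only [coeff_sub, coeff_map, coeff_C_zero, coeff_zero] at this
  simpa using (sub_eq_zero.1 this).symm

theorem sum_isotropic_en_mul {n d u : ℕ} (hn : 0 < n) (hu : u.Coprime n) (b : Fin d → ℤ) :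
    ∑ x ∈ Fintype.piFinset (fun _ : Fin d => Ico (0 : ℤ) n) with (n : ℤ) ∣ ∑ i, x i ^ 2,
      en n (u * ∑ i, b i * x i) =
    ∑ x ∈ Fintype.piFinset (fun _ : Fin d => Ico (0 : ℤ) n) with (n : ℤ) ∣ ∑ i, x i ^ 2,
      en n (∑ i, b i * x i) := by
  have hn' : (0 : ℤ) < n := by exact_mod_cast hn
  obtain ⟨v, hv⟩ := Int.mod_coprime hu
  have hmaps : ∀ (w : ℤ) (x : Fin d → ℤ),
      x ∈ (Fintype.piFinset fun _ : Fin d => Ico (0 : ℤ) n).filter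
        (fun x => (n : ℤ) ∣ ∑ i, x i ^ 2) →
      (fun i => w * x i % n) ∈ (Fintype.piFinset fun _ : Fin d => Ico (0 : ℤ) n).filter
        (fun x => (n : ℤ) ∣ ∑ i, x i ^ 2) := by
    intro w x hx
    rw [Finset.mem_filter] at hx ⊢
    refine ⟨Fintype.mem_piFinset.2 fun i => Finset.mem_Ico.2
      ⟨Int.emod_nonneg _ hn'.ne', Int.emod_lt_of_pos _ hn'⟩, ?_⟩
    have h : ∑ i, (w * x i % n) ^ 2 ≡ w ^ 2 * ∑ i, x i ^ 2 [ZMOD n] := by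
      rw [Finset.mul_sum]
      refine Int.ModEq.sum fun i _ => ?_
      rw [← mul_pow]
      exact (Int.mod_modEq _ _).pow 2
    exact h.dvd_iff.2 (hx.2.mul_left _)
  have hinv : ∀ (w w' : ℤ), w * w' ≡ 1 [ZMOD n] → ∀ x : Fin d → ℤ,
      x ∈ (Fintype.piFinset fun _ : Fin d => Ico (0 : ℤ) n).filter
        (fun x => (n : ℤ) ∣ ∑ i, x i ^ 2) →
      (fun i => w * (w' * x i % n) % n) = x := by
    intro w w' hw x hx
    funext i
    have hi := Finset.mem_Ico.1 (Fintype.mem_piFinset.1 (Finset.mem_filter.1 hx).1 i)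
    have h : w * (w' * x i % n) ≡ x i [ZMOD n] :=
      calc w * (w' * x i % n) ≡ w * (w' * x i) [ZMOD n] := (Int.mod_modEq _ _).mul_left _
        _ = w * w' * x i := by ring
        _ ≡ 1 * x i [ZMOD n] := hw.mul_right _
        _ = x i := one_mul _
    rw [h, Int.emod_eq_of_lt hi.1 hi.2]
  refine Finset.sum_nbij' (fun x i => u * x i % n) (fun x i => v * x i % n)
    (hmaps _) (hmaps _) (hinv v u (by rwa [mul_comm])) (hinv u v hv) fun x _ => ?_
  apply en_congr hn
  rw [Finset.mul_sum]
  refine Int.ModEq.sum fun i _ => ?_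
  rw [mul_left_comm]
  exact ((Int.mod_modEq _ _).mul_left _).symm

theorem exists_int_sum_isotropic {n d : ℕ} (hn : 0 < n) (b : Fin d → ℤ) :
    ∃ m : ℤ, ∑ x ∈ Fintype.piFinset (fun _ : Fin d => Ico (0 : ℤ) n) with
      (n : ℤ) ∣ ∑ i, x i ^ 2, en n (∑ i, b i * x i) = m := by
  have hn' : (0 : ℤ) < n := by exact_mod_cast hn
  refine exists_int_of_aeval_primitiveRoots hn
    (∑ x ∈ Fintype.piFinset (fun _ : Fin d => Ico (0 : ℤ) n) with (n : ℤ) ∣ ∑ i, x i ^ 2,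
      Polynomial.X ^ ((∑ i, b i * x i) % n).toNat) _ fun μ hμ => ?_
  have : NeZero n := ⟨hn.ne'⟩
  obtain ⟨u, -, hu, rfl⟩ := (isPrimitiveRoot_en_one hn).isPrimitiveRoot_iff.1 hμ
  rw [← sum_isotropic_en_mul hn hu, map_sum]
  refine Finset.sum_congr rfl fun x _ => ?_
  rw [map_pow, Polynomial.aeval_X, ← en_mul_nat, ← en_mul_nat, one_mul,
    Int.toNat_of_nonneg (Int.emod_nonneg _ hn'.ne')]
  exact en_congr hn ((Int.mod_modEq _ _).mul_left _)

theorem exists_int_sum_range_prod_quadSum {n d : ℕ} (hn : 0 < n) (b : Fin d → ℤ) :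
    ∃ m : ℤ, ∑ k ∈ range n, ∏ i, quadSum n k (b i) = n * m := by
  obtain ⟨m, hm⟩ := exists_int_sum_isotropic hn b
  refine ⟨m, ?_⟩
  simp only [← sum_piFinset_en]
  rw [Finset.sum_comm, ← hm, Finset.sum_filter, Finset.mul_sum]
  refine Finset.sum_congr rfl fun x _ => ?_
  simp only [en_add, ← Finset.mul_sum]
  simp only [mul_comm _ (∑ i, x i ^ 2), sum_range_en_mul hn]
  split_ifs <;> ring

theorem sum_range_gcd_eq {M : Type*} [AddCommMonoid M] {g m : ℕ} (hg : 0 < g) (f : ℕ → M) :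
    ∑ k ∈ range (g * m) with Nat.gcd k (g * m) = g, f k =
      ∑ k ∈ range m with Nat.gcd k m = 1, f (g * k) := by
  symm
  refine Finset.sum_nbij (fun k => g * k) ?_ ?_ ?_ fun _ _ => rfl
  · intro k hk
    rw [Finset.mem_filter, Finset.mem_range] at hk ⊢
    exact ⟨Nat.mul_lt_mul_of_pos_left hk.1 hg, by rw [Nat.gcd_mul_left, hk.2, mul_one]⟩
  · intro k _ l _ h
    exact Nat.eq_of_mul_eq_mul_left hg h
  · intro k hk
    rw [Finset.mem_coe, Finset.mem_filter, Finset.mem_range] at hk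
    obtain ⟨l, rfl⟩ : g ∣ k := hk.2 ▸ Nat.gcd_dvd_left k (g * m)
    refine ⟨l, ?_, rfl⟩
    rw [Finset.mem_coe, Finset.mem_filter, Finset.mem_range]
    refine ⟨Nat.lt_of_mul_lt_mul_left hk.1, ?_⟩
    rw [Nat.gcd_mul_left] at hk
    exact Nat.eq_of_mul_eq_mul_left hg (by rw [hk.2, mul_one])

theorem exists_int_sum_coprime_prod_quadSum {n d : ℕ} (hn : 0 < n) (hd : 0 < d)
    (b : Fin d → ℤ) :
    ∃ m : ℤ, ∑ k ∈ range n with Nat.gcd k n = 1, ∏ i, quadSum n k (b i) = n * m := by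
  induction n using Nat.strong_induction_on generalizing b with
  | _ n ih =>
  obtain ⟨t, ht⟩ := exists_int_sum_range_prod_quadSum hn b
  have hfib := Finset.sum_fiberwise_of_maps_to (s := range n) (t := n.divisors)
    (g := fun k => Nat.gcd k n)
    (fun k _ => Nat.mem_divisors.2 ⟨Nat.gcd_dvd_right k n, hn.ne'⟩)
    (fun k => ∏ i, quadSum n k (b i))
  rw [ht, ← Finset.add_sum_erase _ _ (Nat.one_mem_divisors.2 hn.ne')] at hfib
  have hrest : ∀ g ∈ n.divisors.erase 1, ∃ m : ℤ,
      ∑ k ∈ range n with Nat.gcd k n = g, ∏ i, quadSum n k (b i) = n * m := by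
    intro g hg
    obtain ⟨hg1, hgn⟩ := Finset.mem_erase.1 hg
    obtain ⟨m, rfl⟩ := Nat.dvd_of_mem_divisors hgn
    have hg0 : 0 < g := Nat.pos_of_mul_pos_right hn
    have hm0 : 0 < m := Nat.pos_of_mul_pos_left hn
    rw [sum_range_gcd_eq hg0]
    simp only [Nat.cast_mul, quadSum_mul hg0 hm0]
    by_cases hb : ∀ i, (g : ℤ) ∣ b i
    · obtain ⟨c, hc⟩ := ih m (by nlinarith [show 2 ≤ g by omega]) hm0 fun i => b i / g
      refine ⟨g ^ (d - 1) * c, ?_⟩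
      simp only [hb, if_true, Finset.prod_mul_distrib, ← Finset.mul_sum, hc, Finset.prod_const,
        Finset.card_univ, Fintype.card_fin]
      obtain ⟨e, rfl⟩ : ∃ e, d = e + 1 := ⟨d - 1, by omega⟩
      rw [Nat.add_sub_cancel]
      push_cast
      ring
    · push Not at hb
      obtain ⟨i, hi⟩ := hb
      refine ⟨0, ?_⟩
      rw [Int.cast_zero, mul_zero]
      refine Finset.sum_eq_zero fun k _ => Finset.prod_eq_zero (Finset.mem_univ i) ?_
      rw [if_neg hi]
  choose! c hc using hrest
  refine ⟨t - ∑ g ∈ n.divisors.erase 1, c g, ?_⟩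
  rw [Finset.sum_congr rfl hc, ← Finset.mul_sum] at hfib
  push_cast
  rw [mul_sub, ← hfib, add_sub_cancel_right]

/-- For `n` odd, `n ∣ g_n(b)`. -/
theorem gsum_div_odd (n d : ℕ) (hn : 0 < n) (hnodd : Odd n) (hd : 0 < d) (b : Fin d → ℤ) :
    ∃ m : ℤ, gsum n d b = n * m := by
  simp only [gsum, sum_piFinset_en]
  exact exists_int_sum_coprime_prod_quadSum hn hd b
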